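/- arXiv:1112.5424 — 9 statements merged into one kernel-verified Lean document; each statement's English description precedes it below -/
import Mathlib

section
/- Let n ≥ 2 be an integer and let δ = 0 if n is even and δ = 1 if n is odd. Let D = {(x,y) ∈ ℝ² : ∃ φ ∈ [0,2π]ⁿ with x = ȷ₁(φ) and y = ȷ₂(φ)} be the attainable set of the bi-objective Diffraction Grating problem. Then the Pareto front of D (for maximization of both coordinates) equals {(x,y) ∈ [δ, n²] × [δ, n²] : x + y = n² + δ}. -/
open Finset Real

/-- ȷ₁(φ) = n + 2·Σ_{0≤k<ℓ≤n−1} cos(φ_ℓ − φ_k) -/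
noncomputable def j1 (n : ℕ) (φ : Fin n → ℝ) : ℝ :=
  n + 2 * ∑ l : Fin n, ∑ k : Fin n, if k < l then Real.cos (φ l - φ k) else 0

/-- ȷ₂(φ) = n + 2·Σ_{0≤k<ℓ≤n−1} cos(π(ℓ−k) + φ_ℓ − φ_k) -/
noncomputable def j2 (n : ℕ) (φ : Fin n → ℝ) : ℝ :=
  n + 2 * ∑ l : Fin n, ∑ k : Fin n,
    if k < l then Real.cos (Real.pi * (((l : ℕ) - (k : ℕ) : ℕ) : ℝ) + (φ l - φ k)) else 0

/-- The attainable set of the bi-objective Diffraction Grating problem. -/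
noncomputable def attainableSet (n : ℕ) : Set (ℝ × ℝ) :=
  {p | ∃ φ : Fin n → ℝ, (∀ k, φ k ∈ Set.Icc (0 : ℝ) (2 * Real.pi)) ∧
    p.1 = j1 n φ ∧ p.2 = j2 n φ}

/-- Pareto front of a set D ⊆ ℝ², for maximization of both coordinates. -/
def paretoFront (D : Set (ℝ × ℝ)) : Set (ℝ × ℝ) :=
  {p | p ∈ D ∧ ¬ ∃ p' ∈ D, p.1 ≤ p'.1 ∧ p.2 ≤ p'.2 ∧ p' ≠ p}

theorem aux_sq {n : ℕ} (s : Finset (Fin n)) (θ : Fin n → ℝ) :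
    (∑ k ∈ s, Real.cos (θ k)) ^ 2 + (∑ k ∈ s, Real.sin (θ k)) ^ 2 =
      ∑ l ∈ s, ∑ k ∈ s, Real.cos (θ l - θ k) := by
  rw [sq, sq, Finset.sum_mul_sum, Finset.sum_mul_sum, ← Finset.sum_add_distrib]
  refine Finset.sum_congr rfl fun l _ => ?_
  rw [← Finset.sum_add_distrib]
  refine Finset.sum_congr rfl fun k _ => ?_
  rw [Real.cos_sub]

theorem aux_le {n : ℕ} (s : Finset (Fin n)) (θ : Fin n → ℝ) :
    (∑ k ∈ s, Real.cos (θ k)) ^ 2 + (∑ k ∈ s, Real.sin (θ k)) ^ 2 ≤ (s.card : ℝ) ^ 2 := by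
  rw [aux_sq]
  calc _ ≤ ∑ l ∈ s, ∑ k ∈ s, (1 : ℝ) :=
        Finset.sum_le_sum fun l _ => Finset.sum_le_sum fun k _ => Real.cos_le_one _
    _ = _ := by simp [sq]

theorem aux_j {n : ℕ} (θ : Fin n → ℝ) :
    (n : ℝ) + 2 * ∑ l : Fin n, ∑ k : Fin n, (if k < l then Real.cos (θ l - θ k) else 0) =
      (∑ k, Real.cos (θ k)) ^ 2 + (∑ k, Real.sin (θ k)) ^ 2 := by
  rw [aux_sq]
  have h : ∀ l k : Fin n, Real.cos (θ l - θ k) =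
      (if k < l then Real.cos (θ l - θ k) else 0) + (if l < k then Real.cos (θ k - θ l) else 0)
      + (if l = k then 1 else 0) := by
    intro l k
    rcases lt_trichotomy l k with h | h | h
    · simp [h, h.not_gt, h.ne, ← Real.cos_neg (θ k - θ l)]
    · subst h; simp
    · simp [h, h.not_gt, h.ne']
  have h2 : ∑ l : Fin n, ∑ k : Fin n, (if l < k then Real.cos (θ k - θ l) else 0) =
      ∑ l : Fin n, ∑ k : Fin n, (if k < l then Real.cos (θ l - θ k) else 0) := Finset.sum_comm
  have h3 : ∑ l : Fin n, ∑ k : Fin n, (if l = k then (1 : ℝ) else 0) = n := by simp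
  rw [Finset.sum_congr rfl fun l _ => Finset.sum_congr rfl fun k _ => h l k]
  simp only [Finset.sum_add_distrib]
  rw [h2, h3]
  ring

/-- Even-index positions. -/
def evs (n : ℕ) : Finset (Fin n) := Finset.univ.filter fun k => Even (k : ℕ)

theorem sum_split {n : ℕ} (f : Fin n → ℝ) :
    ∑ k, f k = ∑ k ∈ evs n, f k + ∑ k ∈ (evs n)ᶜ, f k := (Finset.sum_add_sum_compl _ _).symm

theorem sum_split_neg {n : ℕ} (f : Fin n → ℝ) :
    ∑ k : Fin n, (-1) ^ (k : ℕ) * f k = ∑ k ∈ evs n, f k - ∑ k ∈ (evs n)ᶜ, f k := by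
  rw [sum_split, sub_eq_add_neg, ← Finset.sum_neg_distrib]
  congr 1
  · refine Finset.sum_congr rfl fun k hk => ?_
    have : Even (k : ℕ) := by simpa [evs] using hk
    simp [this.neg_one_pow]
  · refine Finset.sum_congr rfl fun k hk => ?_
    have : Odd (k : ℕ) := by simpa [evs] using hk
    simp [this.neg_one_pow]

theorem j1_eq {n : ℕ} (φ : Fin n → ℝ) : j1 n φ =
    (∑ k ∈ evs n, Real.cos (φ k) + ∑ k ∈ (evs n)ᶜ, Real.cos (φ k)) ^ 2 +
    (∑ k ∈ evs n, Real.sin (φ k) + ∑ k ∈ (evs n)ᶜ, Real.sin (φ k)) ^ 2 := by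
  rw [← sum_split, ← sum_split, ← aux_j]; rfl

theorem j2_aux {n : ℕ} (φ : Fin n → ℝ) : j2 n φ =
    (∑ k : Fin n, Real.cos (φ k + (k : ℕ) * Real.pi)) ^ 2 +
      (∑ k : Fin n, Real.sin (φ k + (k : ℕ) * Real.pi)) ^ 2 := by
  rw [← aux_j, j2]
  congr 2
  refine Finset.sum_congr rfl fun l _ => Finset.sum_congr rfl fun k _ => ?_
  split_ifs with h
  · rw [Nat.cast_sub (le_of_lt h)]
    congr 1
    ring
  · rfl

theorem j2_eq {n : ℕ} (φ : Fin n → ℝ) : j2 n φ =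
    (∑ k ∈ evs n, Real.cos (φ k) - ∑ k ∈ (evs n)ᶜ, Real.cos (φ k)) ^ 2 +
    (∑ k ∈ evs n, Real.sin (φ k) - ∑ k ∈ (evs n)ᶜ, Real.sin (φ k)) ^ 2 := by
  rw [← sum_split_neg, ← sum_split_neg, j2_aux]
  simp only [Real.cos_add_nat_mul_pi, Real.sin_add_nat_mul_pi]

theorem j1_le {n : ℕ} (φ : Fin n → ℝ) : j1 n φ ≤ (n : ℝ) ^ 2 := by
  rw [j1, aux_j]; simpa using aux_le Finset.univ φ

theorem j2_le {n : ℕ} (φ : Fin n → ℝ) : j2 n φ ≤ (n : ℝ) ^ 2 := by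
  rw [j2_aux]; simpa using aux_le Finset.univ fun k : Fin n => φ k + (k : ℕ) * Real.pi

theorem diffraction_grating_pareto_front (n : ℕ) (hn : 2 ≤ n)
    (δ : ℝ) (hδ : δ = if Even n then 0 else 1) :
    paretoFront (attainableSet n) =
      {p : ℝ × ℝ | p.1 ∈ Set.Icc δ ((n : ℝ) ^ 2) ∧ p.2 ∈ Set.Icc δ ((n : ℝ) ^ 2) ∧
        p.1 + p.2 = (n : ℝ) ^ 2 + δ} := by
  have hδ2 : δ ^ 2 = δ := by rw [hδ]; split_ifs <;> norm_num
  have hδle : δ ≤ 1 := by rw [hδ]; split_ifs <;> norm_num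
  have hn2 : (4 : ℝ) ≤ (n : ℝ) ^ 2 := by
    have : (2 : ℝ) ≤ n := by exact_mod_cast hn
    nlinarith
  obtain ⟨a, ha⟩ : ∃ a : ℝ, a = (evs n).card := ⟨_, rfl⟩
  obtain ⟨b, hb⟩ : ∃ b : ℝ, b = ((evs n)ᶜ).card := ⟨_, rfl⟩
  have hab : a + b = n := by
    have := sum_split (n := n) fun _ => (1 : ℝ)
    simp only [Finset.sum_const, nsmul_eq_mul, mul_one, Finset.card_univ, Fintype.card_fin] at this
    rw [ha, hb, this]
  have hab' : a - b = δ := by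
    have h1 := sum_split_neg (n := n) fun _ => (1 : ℝ)
    have h2 := neg_one_geom_sum (R := ℝ) (n := n)
    simp only [Finset.sum_const, nsmul_eq_mul, mul_one] at h1
    rw [ha, hb, ← h1, hδ, ← h2, Finset.sum_range]
  have hsum : ∀ φ : Fin n → ℝ, j1 n φ + j2 n φ ≤ (n : ℝ) ^ 2 + δ := by
    intro φ
    have h1 := aux_le (evs n) φ
    have h2 := aux_le (evs n)ᶜ φ
    rw [← ha] at h1
    rw [← hb] at h2
    rw [j1_eq, j2_eq, ← hδ2, ← hab, ← hab']
    linarith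
  have hatt : ∀ x : ℝ, δ ≤ x → x ≤ (n : ℝ) ^ 2 → (x, (n : ℝ) ^ 2 + δ - x) ∈ attainableSet n := by
    intro x h1 h2
    have hpos : 0 < (n : ℝ) ^ 2 - δ := by linarith
    obtain ⟨c, hc⟩ : ∃ c : ℝ, c = (2 * x - (n : ℝ) ^ 2 - δ) / ((n : ℝ) ^ 2 - δ) := ⟨_, rfl⟩
    have hc1 : -1 ≤ c := by rw [hc, le_div_iff₀ hpos]; linarith
    have hc2 : c ≤ 1 := by rw [hc, div_le_iff₀ hpos]; linarith
    have hcx : c * ((n : ℝ) ^ 2 - δ) = 2 * x - (n : ℝ) ^ 2 - δ := by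
      rw [hc]; field_simp
    have e1 : ∀ g : ℝ → ℝ, ∑ k ∈ evs n, g (if k ∈ evs n then 0 else Real.arccos c) = a * g 0 := by
      intro g
      rw [Finset.sum_congr rfl (g := fun _ => g 0) fun k hk => by rw [if_pos hk]]
      simp [ha]
    have e2 : ∀ g : ℝ → ℝ, ∑ k ∈ (evs n)ᶜ, g (if k ∈ evs n then 0 else Real.arccos c) =
        b * g (Real.arccos c) := by
      intro g
      rw [Finset.sum_congr rfl (g := fun _ => g (Real.arccos c))
        fun k hk => by rw [if_neg (Finset.mem_compl.1 hk)]]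
      simp [hb]
    have hcs := Real.sin_sq_add_cos_sq (Real.arccos c)
    rw [Real.cos_arccos hc1 hc2] at hcs
    have hA : a = (n + δ) / 2 := by linarith
    have hB : b = (n - δ) / 2 := by linarith
    refine ⟨fun k => if k ∈ evs n then 0 else Real.arccos c, ?_, ?_, ?_⟩
    · intro k
      have := Real.pi_pos
      have h3 := Real.arccos_nonneg c
      have h4 := Real.arccos_le_pi c
      dsimp only
      split_ifs <;> constructor <;> linarith
    · rw [j1_eq]
      simp only [e1, e2, e1 Real.cos, e2 Real.cos, e1 Real.sin, e2 Real.sin]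
      rw [Real.cos_arccos hc1 hc2, Real.cos_zero, Real.sin_zero, hA, hB]
      linear_combination (-(n - δ) ^ 2 / 4) * hcs - hcx / 2 + (c / 2 - 1 / 2) * hδ2
    · rw [j2_eq]
      simp only [e1, e2, e1 Real.cos, e2 Real.cos, e1 Real.sin, e2 Real.sin]
      rw [Real.cos_arccos hc1 hc2, Real.cos_zero, Real.sin_zero, hA, hB]
      linear_combination (-(n - δ) ^ 2 / 4) * hcs + hcx / 2 + (-c / 2 - 1 / 2) * hδ2
  ext ⟨x, y⟩
  constructor
  · rintro ⟨⟨φ, hφ, hx, hy⟩, hnd⟩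
    dsimp only at hx hy hnd
    have h1 := j1_le φ
    have h2 := j2_le φ
    have h3 := hsum φ
    rw [← hx, ← hy] at h3
    rw [← hx] at h1
    rw [← hy] at h2
    have h4 : x + y = (n : ℝ) ^ 2 + δ := by
      by_contra hne
      have hlt := lt_of_le_of_ne h3 hne
      apply hnd
      refine ⟨_, hatt (max x δ) (le_max_right _ _) (max_le h1 (by linarith)), le_max_left _ _, ?_, ?_⟩
      · dsimp only
        rcases max_cases x δ with ⟨h, _⟩ | ⟨h, _⟩ <;> rw [h] <;> linarith
      · intro h
        rw [Prod.mk.injEq] at h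
        linarith [h.1, h.2]
    refine ⟨⟨?_, h1⟩, ⟨?_, h2⟩, h4⟩ <;> dsimp only <;> linarith
  · rintro ⟨⟨h1, h2⟩, ⟨h3, h4⟩, h5⟩
    dsimp only at h1 h2 h3 h4 h5
    constructor
    · have := hatt x h1 h2
      rwa [show (n : ℝ) ^ 2 + δ - x = y by linarith] at this
    · rintro ⟨⟨x', y'⟩, ⟨φ, hφ, hx, hy⟩, hxx, hyy, hne⟩
      dsimp only at hx hy hxx hyy
      have h6 := hsum φ
      rw [← hx, ← hy] at h6
      exact hne (Prod.ext (by dsimp only; linarith) (by dsimp only; linarith))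
end

section
/- Let n ≥ 2 be an even integer. For every φ : {0,…,n−1} → ℝ, one has ȷ₁(φ) + ȷ₂(φ) ≤ n². -/
open Finset Real

lemma aux_S (l : ℕ) : ∑ k ∈ range l, (if (l - k) % 2 = 0 then (2:ℝ) else 0)
    = 2 * ((l / 2 : ℕ) : ℝ) := by
  induction l with
  | zero => simp
  | succ l ih =>
    rw [sum_range_succ']
    simp only [Nat.add_sub_add_right, ih, Nat.sub_zero]
    split_ifs with h
    · have : (l + 1) / 2 = l / 2 + 1 := by omega
      rw [this]; push_cast; ring
    · have : (l + 1) / 2 = l / 2 := by omega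
      rw [this]; ring

lemma aux_T (m : ℕ) : ∑ l ∈ range (m + m), 2 * ((l / 2 : ℕ) : ℝ) = 2 * m * (m - 1) := by
  induction m with
  | zero => simp
  | succ m ih =>
    have e : m + 1 + (m + 1) = m + m + 1 + 1 := by ring
    rw [e, sum_range_succ, sum_range_succ, ih]
    have h1 : (m + m) / 2 = m := by omega
    have h2 : (m + m + 1) / 2 = m := by omega
    rw [h1, h2]; push_cast; ring

lemma aux_term (d : ℕ) (x : ℝ) :
    Real.cos x + Real.cos (Real.pi * (d : ℝ) + x) ≤ if d % 2 = 0 then 2 else 0 := by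
  have h : Real.cos (Real.pi * (d : ℝ) + x) = (-1) ^ d * Real.cos x := by
    rw [add_comm, mul_comm, Real.cos_add_nat_mul_pi]
  rw [h]
  split_ifs with hd
  · rw [(Nat.even_iff.2 hd).neg_one_pow]; linarith [Real.cos_le_one x]
  · rw [(Nat.odd_iff.2 (by omega)).neg_one_pow]; linarith

theorem j1_add_j2_le_of_even (n : ℕ) (hn : 2 ≤ n) (hev : Even n) (φ : Fin n → ℝ) :
    j1 n φ + j2 n φ ≤ (n : ℝ) ^ 2 := by
  have key : (∑ l : Fin n, ∑ k : Fin n, if k < l then Real.cos (φ l - φ k) else 0) +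
      (∑ l : Fin n, ∑ k : Fin n, if k < l then
        Real.cos (Real.pi * (((l : ℕ) - (k : ℕ) : ℕ) : ℝ) + (φ l - φ k)) else 0)
      ≤ ∑ l ∈ range n, 2 * ((l / 2 : ℕ) : ℝ) := by
    rw [← sum_add_distrib, ← Fin.sum_univ_eq_sum_range (fun l => 2 * ((l / 2 : ℕ) : ℝ))]
    refine sum_le_sum fun l _ => ?_
    rw [← sum_add_distrib]
    have h1 : 2 * (((l : ℕ) / 2 : ℕ) : ℝ) = ∑ k : Fin n, if (k : ℕ) < l then
        (if ((l : ℕ) - k) % 2 = 0 then (2:ℝ) else 0) else 0 := by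
      rw [Fin.sum_univ_eq_sum_range (fun k => if k < (l : ℕ) then
        (if ((l : ℕ) - k) % 2 = 0 then (2:ℝ) else 0) else 0), ← sum_filter, ← aux_S]
      refine sum_congr ?_ fun _ _ => rfl
      ext k
      have := l.2
      simp only [mem_range, mem_filter]
      omega
    rw [h1]
    refine sum_le_sum fun k _ => ?_
    by_cases h : k < l
    · have h' : (k : ℕ) < l := h
      rw [if_pos h, if_pos h, if_pos h']
      exact aux_term _ _
    · have h' : ¬ (k : ℕ) < l := h
      rw [if_neg h, if_neg h, if_neg h']
      simp
  obtain ⟨m, rfl⟩ := hev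
  rw [aux_T] at key
  unfold j1 j2
  push_cast at key ⊢
  nlinarith [key]
end

section
/- Let n ≥ 3 be an odd integer. For every φ : {0,…,n−1} → ℝ, one has ȷ₁(φ) + ȷ₂(φ) ≤ n² + 1. -/
open Finset Real

theorem aux_inner (l : ℕ) :
    (∑ k ∈ Finset.range l, if k % 2 = l % 2 then (1 : ℝ) else 0) = ((l / 2 : ℕ) : ℝ) := by
  induction l using Nat.twoStepInduction with
  | zero => simp
  | one => simp
  | more l ih _ =>
    have h1 : (l + 2) % 2 = l % 2 := by omega
    have h2 : (l + 2) / 2 = l / 2 + 1 := by omega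
    have h3 : ¬ ((l + 1) % 2 = l % 2) := by omega
    rw [Finset.sum_range_succ, Finset.sum_range_succ, h1, h2, ih]
    simp [h3]

theorem aux_outer (m : ℕ) :
    (∑ l ∈ Finset.range (2 * m + 1), ((l / 2 : ℕ) : ℝ)) = (m : ℝ) ^ 2 := by
  induction m with
  | zero => simp
  | succ m ih =>
    have e : 2 * (m + 1) + 1 = 2 * m + 1 + 1 + 1 := by ring
    have h1 : (2 * m + 1) / 2 = m := by omega
    have h2 : (2 * m + 1 + 1) / 2 = m + 1 := by omega
    rw [e, Finset.sum_range_succ, Finset.sum_range_succ, ih, h1, h2]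
    push_cast
    ring

theorem aux_cos (k l : ℕ) (h : k < l) (x : ℝ) :
    Real.cos x + Real.cos (Real.pi * ((l - k : ℕ) : ℝ) + x)
      ≤ 2 * (if k % 2 = l % 2 then (1 : ℝ) else 0) := by
  have e : Real.cos (Real.pi * ((l - k : ℕ) : ℝ) + x) = (-1) ^ (l - k) * Real.cos x := by
    rw [add_comm, mul_comm, Real.cos_add_nat_mul_pi]
  rw [e]
  split_ifs with hp
  · have : Even (l - k) := by rw [Nat.even_iff]; omega
    rw [this.neg_one_pow]
    linarith [Real.cos_le_one x]
  · have : Odd (l - k) := by rw [Nat.odd_iff]; omega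
    rw [this.neg_one_pow]
    linarith

theorem aux_count (n l : ℕ) (h : l < n) :
    (∑ k ∈ Finset.range n, if k < l then (if k % 2 = l % 2 then (1 : ℝ) else 0) else 0)
      = ((l / 2 : ℕ) : ℝ) := by
  rw [← Finset.sum_filter, ← aux_inner]
  congr 1
  ext k
  simp only [Finset.mem_filter, Finset.mem_range]
  omega

theorem j1_add_j2_le_of_odd (n : ℕ) (hn : 3 ≤ n) (hodd : Odd n) (φ : Fin n → ℝ) :
    j1 n φ + j2 n φ ≤ (n : ℝ) ^ 2 + 1 := by
  obtain ⟨m, rfl⟩ := hodd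
  have key : (∑ l : Fin (2 * m + 1), ∑ k : Fin (2 * m + 1),
        if k < l then Real.cos (φ l - φ k) else 0) +
      (∑ l : Fin (2 * m + 1), ∑ k : Fin (2 * m + 1),
        if k < l then Real.cos (Real.pi * (((l : ℕ) - (k : ℕ) : ℕ) : ℝ) + (φ l - φ k)) else 0)
      ≤ 2 * (m : ℝ) ^ 2 := by
    rw [← aux_outer, ← Fin.sum_univ_eq_sum_range (fun l => ((l / 2 : ℕ) : ℝ)),
      ← Finset.sum_add_distrib, Finset.mul_sum]
    apply Finset.sum_le_sum
    intro l _
    rw [← aux_count (2 * m + 1) l l.2, ← Fin.sum_univ_eq_sum_range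
      (fun k => if k < (l : ℕ) then (if k % 2 = (l : ℕ) % 2 then (1 : ℝ) else 0) else 0),
      ← Finset.sum_add_distrib, Finset.mul_sum]
    apply Finset.sum_le_sum
    intro k _
    by_cases h : k < l
    · have h' : (k : ℕ) < (l : ℕ) := h
      rw [if_pos h, if_pos h, if_pos h']
      exact aux_cos k l h' _
    · have h' : ¬ ((k : ℕ) < (l : ℕ)) := h
      rw [if_neg h, if_neg h, if_neg h']
      simp
  unfold j1 j2
  push_cast
  nlinarith [key]
end

section
/- Let n ≥ 2 be an even integer and t ∈ ℝ. Define φ : {0,…,n−1} → ℝ by φ_k = 0 for even k and φ_k = t for odd k. Then ȷ₁(φ) = (n²/2)·(1 + cos t) and ȷ₂(φ) = (n²/2)·(1 − cos t). -/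
open Finset Real

lemma aux_count_s7 (a b : ℝ) (m : ℕ) :
    ∑ k ∈ range (2 * m), (if Even k then a else b) = m * (a + b) := by
  induction m with
  | zero => simp
  | succ m ih =>
    rw [show 2 * (m + 1) = 2 * m + 1 + 1 by ring, sum_range_succ, sum_range_succ, ih,
      if_pos (by simp), if_neg (by simp [Nat.even_add_one])]
    push_cast; ring

lemma aux_tri (c : ℝ) (m : ℕ) :
    ∑ l ∈ range (2 * m), ∑ k ∈ range l, (if (Even k ↔ Even l) then (1 : ℝ) else c)
      = m * (m - 1) + m ^ 2 * c := by
  induction m with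
  | zero => simp
  | succ m ih =>
    rw [show 2 * (m + 1) = 2 * m + 1 + 1 by ring, sum_range_succ, sum_range_succ, ih]
    have e0 : Even (2 * m) := by simp
    have e1 : ¬ Even (2 * m + 1) := by simp [Nat.even_add_one]
    have h1 := aux_count_s7 1 c m
    have h2 := aux_count_s7 c 1 m
    have h3 : ∑ k ∈ range (2 * m), (if (Even k ↔ Even (2 * m)) then (1 : ℝ) else c)
        = m * (1 + c) := by
      rw [← h1]; exact sum_congr rfl fun k _ => by simp only [e0, iff_true]
    have h4 : ∑ k ∈ range (2 * m), (if (Even k ↔ Even (2 * m + 1)) then (1 : ℝ) else c)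
        = m * (c + 1) := by
      rw [← h2]; exact sum_congr rfl fun k _ => by
        by_cases hk : Even k <;> simp only [e1, hk] <;> simp
    have h5 : (if (Even (2 * m) ↔ Even (2 * m + 1)) then (1 : ℝ) else c) = c := by
      rw [if_neg]; tauto
    rw [sum_range_succ, h3, h4, h5]
    push_cast; ring

lemma aux_fin (c : ℝ) (n m : ℕ) (hm : n = 2 * m) (f : Fin n → Fin n → ℝ)
    (hf : ∀ l k : Fin n, k < l →
      f l k = if (Even (k : ℕ) ↔ Even (l : ℕ)) then (1 : ℝ) else c) :
    (n : ℝ) + 2 * ∑ l : Fin n, ∑ k : Fin n, (if k < l then f l k else 0)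
      = (n : ℝ) ^ 2 / 2 * (1 + c) := by
  have key : ∑ l : Fin n, ∑ k : Fin n, (if k < l then f l k else 0)
      = ∑ l ∈ range n, ∑ k ∈ range l, (if (Even k ↔ Even l) then (1 : ℝ) else c) := by
    rw [← Fin.sum_univ_eq_sum_range
      (fun l => ∑ k ∈ range l, (if (Even k ↔ Even l) then (1 : ℝ) else c)) n]
    refine sum_congr rfl fun l _ => ?_
    have : ∑ k : Fin n, (if k < l then f l k else 0)
        = ∑ k : Fin n, (fun k : ℕ => if k < (l : ℕ) then
          (if (Even k ↔ Even (l : ℕ)) then (1 : ℝ) else c) else 0) k := by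
      refine sum_congr rfl fun k _ => ?_
      by_cases h : k < l
      · have h' : (k : ℕ) < l := h
        simp only [h, h', if_true]; exact hf l k h
      · have h' : ¬ (k : ℕ) < l := h
        simp only [h, h', if_false]
    rw [this, Fin.sum_univ_eq_sum_range (fun k : ℕ => if k < (l : ℕ) then
          (if (Even k ↔ Even (l : ℕ)) then (1 : ℝ) else c) else 0) n, ← sum_filter]
    refine sum_congr ?_ fun _ _ => rfl
    ext k
    have := l.isLt
    simp only [mem_filter, mem_range]; omega
  rw [key, hm, aux_tri]
  push_cast; ring

theorem j1_j2_alternating (n : ℕ) (hn : 2 ≤ n) (hev : Even n) (t : ℝ)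
    (φ : Fin n → ℝ) (hφ : ∀ k : Fin n, φ k = if Even (k : ℕ) then 0 else t) :
    j1 n φ = (n : ℝ) ^ 2 / 2 * (1 + Real.cos t) ∧
    j2 n φ = (n : ℝ) ^ 2 / 2 * (1 - Real.cos t) := by
  obtain ⟨m, hm⟩ := hev
  have hm : n = 2 * m := by omega
  constructor
  · refine aux_fin _ n m hm (fun l k => Real.cos (φ l - φ k)) fun l k _ => ?_
    by_cases hk : Even (k : ℕ) <;> by_cases hl : Even (l : ℕ) <;> simp [hφ, hk, hl]
  · rw [sub_eq_add_neg]
    refine aux_fin _ n m hm (fun l k => Real.cos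
      (Real.pi * (((l : ℕ) - (k : ℕ) : ℕ) : ℝ) + (φ l - φ k))) fun l k h => ?_
    have h' : (k : ℕ) ≤ l := le_of_lt h
    have hp := Nat.even_sub h'
    have hc : ∀ x : ℝ, Real.cos (Real.pi * (((l : ℕ) - (k : ℕ) : ℕ) : ℝ) + x)
        = (-1) ^ ((l : ℕ) - (k : ℕ)) * Real.cos x := fun x => by
      rw [add_comm, mul_comm, Real.cos_add_nat_mul_pi]
    simp only [hc]
    by_cases he : Even ((l : ℕ) - (k : ℕ))
    · rw [he.neg_one_pow]
      have hh := hp.1 he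
      by_cases hk : Even (k : ℕ) <;> by_cases hl : Even (l : ℕ) <;>
        first | (exfalso; tauto) | simp [hφ, hk, hl]
    · rw [(Nat.not_even_iff_odd.1 he).neg_one_pow]
      have hh := fun q => he (hp.2 q)
      by_cases hk : Even (k : ℕ) <;> by_cases hl : Even (l : ℕ) <;>
        first | (exfalso; tauto) | simp [hφ, hk, hl]
end

section
/- Let n ≥ 2 be an even integer and φ : {0,…,n−1} → ℝ. Then ȷ₁(φ) + ȷ₂(φ) = n² if and only if every two even indices j, k have φ_j ≡ φ_k (mod 2π) and every two odd indices j, k have φ_j ≡ φ_k (mod 2π). -/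
open Finset Real

lemma cnt_inner (l : ℕ) : (∑ k ∈ range l, if k % 2 = l % 2 then 1 else 0) = l / 2 := by
  induction l using Nat.twoStepInduction with
  | zero => simp
  | one => simp
  | more l ih _ =>
    rw [Finset.sum_range_succ, Finset.sum_range_succ]
    have h : (l + 2) % 2 = l % 2 := by omega
    rw [h, ih]
    have h2 : ¬ ((l + 1) % 2 = l % 2) := by omega
    simp only [h2, if_true, if_false]
    omega

lemma cnt_outer (m : ℕ) : (∑ l ∈ range (m + m), l / 2) + m = m * m := by
  induction m with
  | zero => simp
  | succ m ih =>
    have : m + 1 + (m + 1) = (m + m) + 1 + 1 := by omega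
    rw [this, Finset.sum_range_succ, Finset.sum_range_succ]
    have h1 : (m + m) / 2 = m := by omega
    have h2 : (m + m + 1) / 2 = m := by omega
    rw [h1, h2]
    nlinarith

lemma cnt_fin (m : ℕ) : (∑ l : Fin (m + m), ∑ k : Fin (m + m),
    if k < l ∧ (k : ℕ) % 2 = (l : ℕ) % 2 then 1 else 0) + m = m * m := by
  rw [← cnt_outer m, ← Fin.sum_univ_eq_sum_range (fun l => l / 2)]
  congr 1
  apply Finset.sum_congr rfl
  intro l _
  rw [← cnt_inner l]
  simp only [Fin.lt_def]
  rw [Fin.sum_univ_eq_sum_range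
    (fun k => if k < (l : ℕ) ∧ k % 2 = (l : ℕ) % 2 then 1 else 0)]
  symm
  apply Finset.sum_subset_zero_on_sdiff
  · intro x hx
    have := l.2
    simp only [Finset.mem_range] at *
    omega
  · intro x hx
    simp only [Finset.mem_sdiff, Finset.mem_range] at hx
    simp [hx.2]
  · intro x hx
    simp only [Finset.mem_range] at hx
    simp [hx]

lemma term_eq (a b : ℕ) (h : b < a) (x : ℝ) :
    Real.cos x + Real.cos (Real.pi * ((a - b : ℕ) : ℝ) + x) =
      if b % 2 = a % 2 then 2 * Real.cos x else 0 := by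
  rw [add_comm (Real.pi * _) x, mul_comm Real.pi, Real.cos_add_nat_mul_pi]
  split_ifs with hp
  · have : Even (a - b) := by rw [Nat.even_iff]; omega
    rw [this.neg_one_pow]; ring
  · have : Odd (a - b) := by rw [Nat.odd_iff]; omega
    rw [this.neg_one_pow]; ring

lemma deficit (n : ℕ) (hev : Even n) (φ : Fin n → ℝ) :
    (n : ℝ) ^ 2 - (j1 n φ + j2 n φ) = 4 * ∑ l : Fin n, ∑ k : Fin n,
      if k < l ∧ (k : ℕ) % 2 = (l : ℕ) % 2 then 1 - Real.cos (φ l - φ k) else 0 := by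
  obtain ⟨m, rfl⟩ := hev
  have hc := congrArg (Nat.cast : ℕ → ℝ) (cnt_fin m)
  push_cast at hc
  have hs : (∑ l : Fin (m + m), ∑ k : Fin (m + m),
        if k < l then Real.cos (φ l - φ k) else 0) +
      (∑ l : Fin (m + m), ∑ k : Fin (m + m),
        if k < l then Real.cos (Real.pi * (((l : ℕ) - (k : ℕ) : ℕ) : ℝ) + (φ l - φ k)) else 0)
      + 2 * (∑ l : Fin (m + m), ∑ k : Fin (m + m),
      if k < l ∧ (k : ℕ) % 2 = (l : ℕ) % 2 then 1 - Real.cos (φ l - φ k) else 0)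
      = 2 * ∑ l : Fin (m + m), ∑ k : Fin (m + m),
        if k < l ∧ (k : ℕ) % 2 = (l : ℕ) % 2 then (1 : ℝ) else 0 := by
    simp only [Finset.mul_sum, ← Finset.sum_add_distrib]
    refine Finset.sum_congr rfl fun l _ => Finset.sum_congr rfl fun k _ => ?_
    by_cases h : k < l
    · have := term_eq l k h (φ l - φ k)
      simp only [h, if_true, true_and]
      rw [this]
      split_ifs <;> ring
    · simp [h]
  unfold j1 j2
  push_cast
  linarith

theorem j1_add_j2_eq_max_iff (n : ℕ) (hn : 2 ≤ n) (hev : Even n) (φ : Fin n → ℝ) :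
    j1 n φ + j2 n φ = (n : ℝ) ^ 2 ↔
      ((∀ j k : Fin n, Even (j : ℕ) → Even (k : ℕ) →
          ∃ m : ℤ, φ j - φ k = 2 * Real.pi * m) ∧
       (∀ j k : Fin n, Odd (j : ℕ) → Odd (k : ℕ) →
          ∃ m : ℤ, φ j - φ k = 2 * Real.pi * m)) := by
  have hd := deficit n hev φ
  have hnn : ∀ l k : Fin n, (0 : ℝ) ≤
      if k < l ∧ (k : ℕ) % 2 = (l : ℕ) % 2 then 1 - Real.cos (φ l - φ k) else 0 := by
    intro l k
    split_ifs
    · linarith [Real.cos_le_one (φ l - φ k)]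
    · exact le_rfl
  constructor
  · intro h
    rw [h, sub_self] at hd
    have h0 := (mul_eq_zero.mp hd.symm).resolve_left (by norm_num)
    rw [Finset.sum_eq_zero_iff_of_nonneg
      (fun l _ => Finset.sum_nonneg fun k _ => hnn l k)] at h0
    have key : ∀ l k : Fin n, k < l → (k : ℕ) % 2 = (l : ℕ) % 2 →
        ∃ m : ℤ, φ l - φ k = 2 * Real.pi * m := by
      intro l k hkl hp
      have h1 := h0 l (Finset.mem_univ _)
      rw [Finset.sum_eq_zero_iff_of_nonneg (fun k _ => hnn l k)] at h1
      have h2 := h1 k (Finset.mem_univ _)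
      rw [if_pos ⟨hkl, hp⟩] at h2
      obtain ⟨m, hm⟩ := (Real.cos_eq_one_iff _).mp (by linarith : Real.cos (φ l - φ k) = 1)
      exact ⟨m, by rw [← hm]; ring⟩
    have key2 : ∀ l k : Fin n, (k : ℕ) % 2 = (l : ℕ) % 2 →
        ∃ m : ℤ, φ l - φ k = 2 * Real.pi * m := by
      intro l k hp
      rcases lt_trichotomy k l with hl | rfl | hl
      · exact key l k hl hp
      · exact ⟨0, by simp⟩
      · obtain ⟨m, hm⟩ := key k l hl hp.symm
        exact ⟨-m, by push_cast; linarith⟩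
    refine ⟨fun j k hj hk => key2 j k ?_, fun j k hj hk => key2 j k ?_⟩
    · rw [Nat.even_iff] at hj hk; omega
    · rw [Nat.odd_iff] at hj hk; omega
  · rintro ⟨he, ho⟩
    have h0 : (∑ l : Fin n, ∑ k : Fin n,
      if k < l ∧ (k : ℕ) % 2 = (l : ℕ) % 2 then 1 - Real.cos (φ l - φ k) else 0) = 0 := by
      refine Finset.sum_eq_zero fun l _ => Finset.sum_eq_zero fun k _ => ?_
      split_ifs with h
      · have : ∃ m : ℤ, φ l - φ k = 2 * Real.pi * m := by
          rcases Nat.even_or_odd (l : ℕ) with hl | hl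
          · exact he l k hl (by rw [Nat.even_iff] at *; omega)
          · exact ho l k hl (by rw [Nat.odd_iff] at *; omega)
        obtain ⟨m, hm⟩ := this
        rw [(Real.cos_eq_one_iff _).mpr ⟨m, by rw [hm]; ring⟩, sub_self]
      · rfl
    rw [h0] at hd
    linarith
end

section
/- Let n ≥ 2 be an integer, h, q real numbers, ε ≥ 0, and φ : {0,…,n−1} → ℝ. Let δφ = (δφ_0,…,δφ_{n−1}) be a random vector whose components are independent, each with law N(0,ε²). Then E[J_DG(q, φ + δφ)] = n·(1 − exp(−ε²)) + exp(−ε²)·J_DG(q, φ). -/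
open Finset MeasureTheory ProbabilityTheory Real

/-- J_DG(q,φ) = n + 2·Σ_{0≤k<ℓ≤n−1} cos(q·h·(ℓ−k) + φ_ℓ − φ_k) -/
noncomputable def JDG (n : ℕ) (h q : ℝ) (φ : Fin n → ℝ) : ℝ :=
  n + 2 * ∑ l : Fin n, ∑ k : Fin n,
    if k < l then Real.cos (q * h * (((l : ℕ) - (k : ℕ) : ℕ) : ℝ) + (φ l - φ k)) else 0

lemma gauss_char_one (v : NNReal) (t : ℝ) :
    ∫ x : ℝ, Complex.exp ((t : ℂ) * x * Complex.I) ∂(gaussianReal 0 v) =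
      Complex.exp (-(v : ℂ) * t ^ 2 / 2) := by
  have h1 := charFun_gaussianReal (μ := 0) (v := v) t
  rw [charFun_apply_real] at h1
  rw [h1]
  congr 1
  push_cast
  ring

lemma gauss_cos_pair (n : ℕ) (v : NNReal) (a : ℝ) (l k : Fin n) (hkl : k ≠ l) :
    ∫ x : Fin n → ℝ, Real.cos (a + (x l - x k)) ∂(Measure.pi fun _ : Fin n => gaussianReal 0 v) =
      Real.exp (-(v : ℝ)) * Real.cos a := by
  set t : Fin n → ℝ := fun i => (if i = l then 1 else 0) - (if i = k then 1 else 0) with ht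
  have h1 := integral_fintype_prod_eq_prod (μ := fun _ : Fin n => gaussianReal 0 v)
    (f := fun i (x : ℝ) => Complex.exp ((t i : ℂ) * x * Complex.I))
  simp only [gauss_char_one, ← Complex.exp_sum] at h1
  have h2 : ∀ x : Fin n → ℝ, ∑ i, (t i : ℂ) * x i * Complex.I
      = ((x l - x k : ℝ) : ℂ) * Complex.I := by
    intro x
    have h9 : ∑ i, t i * x i = x l - x k := by
      simp [ht, sub_mul, Finset.sum_sub_distrib]
    rw [← Finset.sum_mul, ← h9]
    push_cast
    rfl
  have h3 : ∑ i, -(v : ℂ) * (t i : ℂ) ^ 2 / 2 = ((-(v : ℝ) : ℝ) : ℂ) := by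
    have h4 : ∀ i, t i ^ 2 = (if i = l then 1 else 0) + (if i = k then 1 else 0) := by
      intro i
      by_cases h5 : i = l
      · subst h5
        simp [ht, hkl.symm]
      · by_cases h6 : i = k <;> simp [ht, h5, h6]
        simp [hkl]
    have h7 : ∑ i, t i ^ 2 = 2 := by
      simp only [h4, Finset.sum_add_distrib]
      simp
      norm_num
    rw [← Finset.sum_div, ← Finset.mul_sum]
    have : ∑ i, (t i : ℂ) ^ 2 = 2 := by exact_mod_cast h7
    rw [this]
    push_cast
    ring
  simp only [h2, h3] at h1
  have hm : Integrable (fun x : Fin n → ℝ => Complex.exp (a * Complex.I) *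
      Complex.exp (((x l - x k : ℝ) : ℂ) * Complex.I))
      (Measure.pi fun _ : Fin n => gaussianReal 0 v) := by
    refine Integrable.of_bound (C := 1) ?_ ?_
    · exact Continuous.aestronglyMeasurable (by fun_prop)
    · refine Filter.Eventually.of_forall fun x => ?_
      rw [norm_mul, Complex.norm_exp_ofReal_mul_I, Complex.norm_exp_ofReal_mul_I, one_mul]
  have h8 := Complex.reCLM.integral_comp_comm hm
  rw [integral_const_mul, h1, ← Complex.ofReal_exp] at h8
  simp only [Complex.reCLM_apply, Complex.re_mul_ofReal, Complex.exp_ofReal_mul_I_re,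
    ← Complex.exp_add, ← add_mul, ← Complex.ofReal_add] at h8
  rw [h8, mul_comm]

theorem JDG_noisy_mean (n : ℕ) (hn : 2 ≤ n) (h q : ℝ) (ε : ℝ) (hε : 0 ≤ ε)
    (φ : Fin n → ℝ) :
    (∫ δφ : Fin n → ℝ, JDG n h q (fun k => φ k + δφ k)
        ∂(Measure.pi fun _ : Fin n => gaussianReal 0 ⟨ε ^ 2, sq_nonneg ε⟩)) =
      (n : ℝ) * (1 - Real.exp (-ε ^ 2)) + Real.exp (-ε ^ 2) * JDG n h q φ := by
  set v : NNReal := ⟨ε ^ 2, sq_nonneg ε⟩ with hv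
  have hve : (v : ℝ) = ε ^ 2 := rfl
  have hi : ∀ l k : Fin n, Integrable (fun x : Fin n → ℝ =>
      if k < l then Real.cos (q * h * (((l : ℕ) - (k : ℕ) : ℕ) : ℝ) + (φ l + x l - (φ k + x k)))
      else 0) (Measure.pi fun _ : Fin n => gaussianReal 0 v) := by
    intro l k
    split_ifs
    · refine Integrable.of_bound (C := 1) ?_ ?_
      · exact Continuous.aestronglyMeasurable (by fun_prop)
      · exact Filter.Eventually.of_forall fun x => Real.abs_cos_le_one _
    · exact integrable_zero _ _ _
  have hs : ∀ l : Fin n, Integrable (fun x : Fin n → ℝ => ∑ k : Fin n,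
      if k < l then Real.cos (q * h * (((l : ℕ) - (k : ℕ) : ℕ) : ℝ) + (φ l + x l - (φ k + x k)))
      else 0) (Measure.pi fun _ : Fin n => gaussianReal 0 v) :=
    fun l => integrable_finsetSum _ fun k _ => hi l k
  have he : ∀ l k : Fin n, ∫ x : Fin n → ℝ, (if k < l then
        Real.cos (q * h * (((l : ℕ) - (k : ℕ) : ℕ) : ℝ) + (φ l + x l - (φ k + x k))) else 0)
        ∂(Measure.pi fun _ : Fin n => gaussianReal 0 v) =
      Real.exp (-ε ^ 2) * (if k < l then
        Real.cos (q * h * (((l : ℕ) - (k : ℕ) : ℕ) : ℝ) + (φ l - φ k)) else 0) := by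
    intro l k
    split_ifs with hkl
    · rw [← hve, ← gauss_cos_pair n v _ l k hkl.ne]
      congr 1
      ext x
      congr 1
      ring
    · simp
  unfold JDG
  rw [integral_add (integrable_const _) ((integrable_finsetSum _ fun l _ => hs l).const_mul 2),
    integral_const_mul, integral_finsetSum _ fun l _ => hs l]
  simp only [integral_finsetSum _ fun k _ => hi _ k, he, ← Finset.mul_sum]
  simp
  ring
end

section
/- Let n ≥ 2 be an integer, h, b, q real numbers, ε ≥ 0, and φ : {0,…,n−1} → ℝ. Let δφ = (δφ_0,…,δφ_{n−1}) be a random vector whose components are independent, each with law N(0,ε²). Then E[I_DG(q, φ + δφ)] = exp(−ε²)·I_DG(q, φ) + sinc(q·b/2)²·(1 − exp(−ε²))/n. -/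
open Finset MeasureTheory ProbabilityTheory Real

/-- sinc(x) = sin(x)/x for x ≠ 0 and sinc(0) = 1. -/
noncomputable def sinc (x : ℝ) : ℝ := if x = 0 then 1 else Real.sin x / x

/-- I_DG(q,φ) = (1/n²)·sinc(q·b/2)²·J_DG(q,φ) -/
noncomputable def IDG (n : ℕ) (h b q : ℝ) (φ : Fin n → ℝ) : ℝ :=
  1 / (n : ℝ) ^ 2 * _root_.sinc (q * b / 2) ^ 2 * JDG n h q φ

lemma key_char (n : ℕ) (v : NNReal) (c : Fin n → ℝ) :
    (∫ x : Fin n → ℝ, Complex.exp (((∑ j, c j * x j : ℝ) : ℂ) * Complex.I)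
      ∂(Measure.pi fun _ : Fin n => gaussianReal 0 v)) =
      Complex.exp (((-(v : ℝ) / 2 * ∑ j, c j ^ 2 : ℝ)) : ℂ) := by
  have h1 : ∀ x : Fin n → ℝ, Complex.exp (((∑ j, c j * x j : ℝ) : ℂ) * Complex.I)
      = ∏ j, Complex.exp ((c j : ℂ) * (x j : ℂ) * Complex.I) := by
    intro x
    rw [← Complex.exp_sum]
    push_cast
    rw [Finset.sum_mul]
  simp_rw [h1]
  rw [integral_fintype_prod_eq_prod (𝕜 := ℂ)
    (f := fun j (y : ℝ) => Complex.exp ((c j : ℂ) * (y : ℂ) * Complex.I))]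
  simp_rw [← charFun_apply_real, charFun_gaussianReal]
  rw [← Complex.exp_sum]
  congr 1
  push_cast
  rw [Finset.mul_sum]
  refine Finset.sum_congr rfl fun j _ => ?_
  ring

lemma key_cos (n : ℕ) (v : NNReal) (k l : Fin n) (hkl : k ≠ l) (a : ℝ) :
    (∫ x : Fin n → ℝ, Real.cos (a + (x l - x k))
      ∂(Measure.pi fun _ : Fin n => gaussianReal 0 v)) = Real.exp (-(v : ℝ)) * Real.cos a := by
  set μ := (Measure.pi fun _ : Fin n => gaussianReal 0 v) with hμ
  let c : Fin n → ℝ := fun j => (if j = l then 1 else 0) - (if j = k then 1 else 0)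
  have hs : ∀ x : Fin n → ℝ, ∑ j, c j * x j = x l - x k := by
    intro x
    simp [c, sub_mul, Finset.sum_sub_distrib]
  have hc : ∑ j, c j ^ 2 = 2 := by
    have : ∀ j, c j ^ 2 = (if j = l then 1 else 0) + (if j = k then 1 else 0) := by
      intro j
      by_cases h1 : j = l
      · subst h1
        simp [c, hkl.symm]
      · simp [c, h1]
    simp_rw [this, Finset.sum_add_distrib]
    simp
    norm_num
  have hk := key_char n v c
  simp_rw [hs, hc] at hk
  have hint : Integrable (fun x : Fin n → ℝ =>
      Complex.exp ((a : ℂ) * Complex.I) * Complex.exp (((x l - x k : ℝ) : ℂ) * Complex.I)) μ := by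
    refine Integrable.of_bound (C := 1) (by
      apply Continuous.aestronglyMeasurable
      fun_prop) ?_
    refine Filter.Eventually.of_forall fun x => ?_
    rw [norm_mul, Complex.norm_exp_ofReal_mul_I, Complex.norm_exp_ofReal_mul_I]
    norm_num
  have hre := integral_re (𝕜 := ℂ) hint
  rw [integral_const_mul, hk] at hre
  have e : ∀ x : Fin n → ℝ, Real.cos (a + (x l - x k)) = RCLike.re
    (Complex.exp ((a : ℂ) * Complex.I) * Complex.exp (((x l - x k : ℝ) : ℂ) * Complex.I)) := by
    intro x
    rw [← Complex.exp_add, ← add_mul, ← Complex.ofReal_add]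
    exact (Complex.exp_ofReal_mul_I_re _).symm
  simp_rw [e]
  rw [hre, ← Complex.ofReal_exp]
  change (_ * _ : ℂ).re = _
  rw [Complex.re_mul_ofReal, Complex.exp_ofReal_mul_I_re, mul_comm]
  congr 2
  ring

lemma int_cos (n : ℕ) (v : NNReal) (k l : Fin n) (a : ℝ) :
    Integrable (fun x : Fin n → ℝ => Real.cos (a + (x l - x k)))
      (Measure.pi fun _ : Fin n => gaussianReal 0 v) := by
  refine Integrable.of_bound (C := 1) (by
    apply Continuous.aestronglyMeasurable
    fun_prop) ?_
  exact Filter.Eventually.of_forall fun x => Real.abs_cos_le_one _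

theorem IDG_noisy_mean (n : ℕ) (hn : 2 ≤ n) (h b q : ℝ) (ε : ℝ) (hε : 0 ≤ ε)
    (φ : Fin n → ℝ) :
    (∫ δφ : Fin n → ℝ, IDG n h b q (fun k => φ k + δφ k)
        ∂(Measure.pi fun _ : Fin n => gaussianReal 0 ⟨ε ^ 2, sq_nonneg ε⟩)) =
      Real.exp (-ε ^ 2) * IDG n h b q φ +
        _root_.sinc (q * b / 2) ^ 2 * ((1 - Real.exp (-ε ^ 2)) / n) := by
  have hn0 : (n : ℝ) ≠ 0 := by
    have : n ≠ 0 := by omega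
    exact_mod_cast this
  set v : NNReal := ⟨ε ^ 2, sq_nonneg ε⟩ with hv
  have hvv : (v : ℝ) = ε ^ 2 := rfl
  set μ := (Measure.pi fun _ : Fin n => gaussianReal 0 v) with hμ
  have hterm : ∀ (l k : Fin n) (x : Fin n → ℝ),
      (q * h * (((l : ℕ) - (k : ℕ) : ℕ) : ℝ) + ((φ l + x l) - (φ k + x k))) =
      (q * h * (((l : ℕ) - (k : ℕ) : ℕ) : ℝ) + (φ l - φ k)) + (x l - x k) := by
    intros
    ring
  have hi : ∀ l k : Fin n, Integrable (fun x : Fin n → ℝ => if k < l then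
      Real.cos ((q * h * (((l : ℕ) - (k : ℕ) : ℕ) : ℝ) + (φ l - φ k)) + (x l - x k)) else 0) μ := by
    intro l k
    split_ifs
    · exact int_cos n v k l _
    · exact integrable_zero _ _ _
  have hJ : ∫ x, JDG n h q (fun k => φ k + x k) ∂μ =
      n + Real.exp (-ε ^ 2) * (JDG n h q φ - n) := by
    unfold JDG
    simp_rw [hterm]
    rw [integral_add (integrable_const _)
      ((integrable_finset_sum _ fun l _ => integrable_finset_sum _ fun k _ => hi l k).const_mul 2),
      integral_const_mul,
      integral_finset_sum _ (fun l _ => integrable_finset_sum _ fun k _ => hi l k)]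
    simp_rw [integral_finset_sum _ (fun k _ => hi _ k)]
    have : ∀ l k : Fin n, ∫ x, (if k < l then
      Real.cos ((q * h * (((l : ℕ) - (k : ℕ) : ℕ) : ℝ) + (φ l - φ k)) + (x l - x k)) else 0) ∂μ
      = Real.exp (-ε ^ 2) * (if k < l then
      Real.cos (q * h * (((l : ℕ) - (k : ℕ) : ℕ) : ℝ) + (φ l - φ k)) else 0) := by
      intro l k
      split_ifs with hlt
      · rw [key_cos n v k l hlt.ne, hvv]
      · simp
    simp_rw [this, ← Finset.mul_sum]
    simp
    ring
  unfold IDG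
  rw [integral_const_mul, hJ]
  field_simp
  ring
end

section
/- Let n ≥ 2 be an integer, h, q real numbers, ε ≥ 0, and φ : {0,…,n−1} → ℝ. Let δφ = (δφ_0,…,δφ_{n−1}) be a random vector whose components are independent, each with law N(0,ε²). Then the variance of the random variable J_DG(q, φ + δφ) satisfies Var[J_DG(q, φ + δφ)] ≤ n(n−1)·[ (1 − exp(−4ε²)) + 2·exp(−ε²)·(1 − exp(−2ε²))·(n−2) ]. -/
open Finset MeasureTheory ProbabilityTheory Real

noncomputable def auxW {n : ℕ} (p : Fin n × Fin n) (i : Fin n) : ℝ :=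
  (if i = p.1 then 1 else 0) - (if i = p.2 then 1 else 0)

lemma auxW_sum {n : ℕ} (p : Fin n × Fin n) (f : Fin n → ℝ) :
    ∑ i, auxW p i * f i = f p.1 - f p.2 := by
  simp [auxW, sub_mul, Finset.sum_sub_distrib]

lemma aux_expect {n : ℕ} (v : NNReal) (a : ℝ) (w : Fin n → ℝ) :
    ∫ x, Real.cos (a + ∑ i, w i * x i) ∂(Measure.pi fun _ : Fin n => gaussianReal 0 v)
      = Real.cos a * Real.exp (-(v * ∑ i, w i ^ 2) / 2) := by
  set μ := Measure.pi fun _ : Fin n => gaussianReal 0 v with hμ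
  have h1 : ∫ x, Complex.exp ((a + ∑ i, w i * x i : ℝ) * Complex.I) ∂μ
      = Complex.exp (a * Complex.I) * Complex.exp (-(v * ∑ i, w i ^ 2 : ℝ) / 2) := by
    have : ∀ x : Fin n → ℝ, Complex.exp ((a + ∑ i, w i * x i : ℝ) * Complex.I)
        = Complex.exp (a * Complex.I) * ∏ i, Complex.exp (w i * x i * Complex.I) := by
      intro x
      rw [← Complex.exp_sum, ← Complex.exp_add]
      congr 1
      push_cast
      rw [add_mul, Finset.sum_mul]
    simp_rw [this]
    rw [integral_const_mul]
    congr 1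
    rw [hμ, integral_fintype_prod_eq_prod (fun i (y : ℝ) => Complex.exp (w i * y * Complex.I))]
    have h2 : ∀ i, ∫ y : ℝ, Complex.exp (w i * y * Complex.I) ∂(gaussianReal 0 v)
        = Complex.exp (-(v * w i ^ 2) / 2) := by
      intro i
      rw [← charFun_apply_real, charFun_gaussianReal]
      congr 1
      push_cast
      ring
    simp_rw [h2]
    rw [← Complex.exp_sum]
    congr 1
    push_cast
    rw [← Finset.sum_div, Finset.sum_neg_distrib, Finset.mul_sum]
  have h3 : ∀ x : Fin n → ℝ, Real.cos (a + ∑ i, w i * x i)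
      = Complex.reCLM (Complex.exp ((a + ∑ i, w i * x i : ℝ) * Complex.I)) := by
    intro x
    rw [Complex.reCLM_apply, Complex.exp_ofReal_mul_I_re]
  simp_rw [h3]
  rw [ContinuousLinearMap.integral_comp_comm, h1]
  · have : Complex.exp (-(v * ∑ i, w i ^ 2 : ℝ) / 2)
        = ((Real.exp (-(v * ∑ i, w i ^ 2) / 2) : ℝ) : ℂ) := by push_cast; rfl
    rw [this, Complex.reCLM_apply, Complex.re_mul_ofReal, Complex.exp_ofReal_mul_I_re]
  · apply Integrable.of_bound (C := 1)
    · apply Continuous.aestronglyMeasurable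
      fun_prop
    · filter_upwards with x
      rw [Complex.norm_exp_ofReal_mul_I]

lemma aux_cov_alg (A B e u s : ℝ) (he : 0 ≤ e) (hu : 0 ≤ u) (hA : |A| ≤ 1) (hB : |B| ≤ 1) :
    (1/2) * (A * (e * Real.exp (-(u * s))) + B * (e * Real.exp (u * s))) - (1/2) * (A + B) * e
      ≤ (1/2) * e * (Real.exp (u * |s|) - Real.exp (-(u * |s|))) := by
  obtain ⟨hA1, hA2⟩ := abs_le.1 hA
  obtain ⟨hB1, hB2⟩ := abs_le.1 hB
  suffices A * (Real.exp (-(u * s)) - 1) + B * (Real.exp (u * s) - 1)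
      ≤ Real.exp (u * |s|) - Real.exp (-(u * |s|)) by
    nlinarith [mul_le_mul_of_nonneg_left this he]
  rcases le_total 0 s with hs | hs
  · rw [abs_of_nonneg hs]
    have h1 : 1 ≤ Real.exp (u * s) := Real.one_le_exp (by positivity)
    have h2 : Real.exp (-(u * s)) ≤ 1 := Real.exp_le_one_iff.2 (by have := mul_nonneg hu hs; linarith)
    nlinarith
  · rw [abs_of_nonpos hs]
    have h0 := mul_nonneg hu (neg_nonneg.2 hs)
    have h1 : 1 ≤ Real.exp (-(u * s)) := Real.one_le_exp (by linarith)
    have h2 : Real.exp (u * s) ≤ 1 := Real.exp_le_one_iff.2 (by linarith)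
    rw [mul_neg, neg_neg]
    nlinarith

lemma aux_int {n : ℕ} (v : NNReal) (f : (Fin n → ℝ) → ℝ) (hf : Continuous f)
    (hb : ∀ x, |f x| ≤ 1) :
    Integrable f (Measure.pi fun _ : Fin n => gaussianReal 0 v) :=
  Integrable.of_bound hf.aestronglyMeasurable 1 (Filter.Eventually.of_forall hb)

lemma aux_cov {n : ℕ} (v : NNReal) (a b : ℝ) (w z : Fin n → ℝ)
    (μ : Measure (Fin n → ℝ)) (hμ : μ = Measure.pi fun _ : Fin n => gaussianReal 0 v) :
    (∫ x, Real.cos (a + ∑ i, w i * x i) * Real.cos (b + ∑ i, z i * x i) ∂μ)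
      - (∫ x, Real.cos (a + ∑ i, w i * x i) ∂μ) * (∫ x, Real.cos (b + ∑ i, z i * x i) ∂μ)
      ≤ (1/2) * Real.exp (-(v * (∑ i, w i ^ 2 + ∑ i, z i ^ 2)) / 2) *
        (Real.exp (v * |∑ i, w i * z i|) - Real.exp (-(v * |∑ i, w i * z i|))) := by
  have h1 : ∀ x : Fin n → ℝ, Real.cos (a + ∑ i, w i * x i) * Real.cos (b + ∑ i, z i * x i)
      = (1/2) * (Real.cos ((a + b) + ∑ i, (w i + z i) * x i)
          + Real.cos ((a - b) + ∑ i, (w i - z i) * x i)) := by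
    intro x
    have e1 : (a + b) + ∑ i, (w i + z i) * x i
        = (a + ∑ i, w i * x i) + (b + ∑ i, z i * x i) := by
      simp_rw [add_mul, Finset.sum_add_distrib]; ring
    have e2 : (a - b) + ∑ i, (w i - z i) * x i
        = (a + ∑ i, w i * x i) - (b + ∑ i, z i * x i) := by
      simp_rw [sub_mul, Finset.sum_sub_distrib]; ring
    rw [e1, e2]
    generalize a + ∑ i, w i * x i = A
    generalize b + ∑ i, z i * x i = B
    rw [Real.cos_add, Real.cos_sub]; ring
  simp_rw [h1]
  rw [integral_const_mul, hμ, integral_add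
    (aux_int v _ (by fun_prop) (fun x => Real.abs_cos_le_one _))
    (aux_int v _ (by fun_prop) (fun x => Real.abs_cos_le_one _))]
  rw [aux_expect, aux_expect, aux_expect, aux_expect]
  have s1 : ∑ i, (w i + z i) ^ 2 = ∑ i, w i ^ 2 + ∑ i, z i ^ 2 + 2 * ∑ i, w i * z i := by
    rw [Finset.mul_sum, ← Finset.sum_add_distrib, ← Finset.sum_add_distrib]
    exact Finset.sum_congr rfl (fun i _ => by ring)
  have s2 : ∑ i, (w i - z i) ^ 2 = ∑ i, w i ^ 2 + ∑ i, z i ^ 2 - 2 * ∑ i, w i * z i := by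
    rw [Finset.mul_sum, ← Finset.sum_add_distrib, ← Finset.sum_sub_distrib]
    exact Finset.sum_congr rfl (fun i _ => by ring)
  rw [s1, s2]
  generalize ∑ i, w i ^ 2 = W
  generalize ∑ i, z i ^ 2 = Z
  generalize ∑ i, w i * z i = S
  have := aux_cov_alg (Real.cos (a + b)) (Real.cos (a - b)) (Real.exp (-(v * (W + Z)) / 2)) v S
    (Real.exp_nonneg _) v.2 (Real.abs_cos_le_one _) (Real.abs_cos_le_one _)
  refine le_trans (le_of_eq ?_) this
  rw [← Real.exp_add, ← Real.exp_add]
  have t1 : -(v * (W + Z + 2 * S)) / 2 = -(v * (W + Z)) / 2 + -(v * S) := by ring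
  have t2 : -(v * (W + Z - 2 * S)) / 2 = -(v * (W + Z)) / 2 + v * S := by ring
  have t3 : Real.exp (-(v * (W + Z)) / 2) = Real.exp (-(v * W) / 2) * Real.exp (-(v * Z) / 2) := by
    rw [← Real.exp_add]; congr 1; ring
  rw [t1, t2, t3, Real.cos_add, Real.cos_sub]
  ring

noncomputable def auxD {n : ℕ} (i j : Fin n) : ℝ := if i = j then 1 else 0

lemma aux_bound {n : ℕ} (v : ℝ) (p r : Fin n × Fin n) :
    (1/2) * Real.exp (-(v * (∑ i, auxW p i ^ 2 + ∑ i, auxW r i ^ 2)) / 2) *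
        (Real.exp (v * |∑ i, auxW p i * auxW r i|) - Real.exp (-(v * |∑ i, auxW p i * auxW r i|)))
    ≤ (1 - auxD p.1 p.2) * ((1 - auxD r.1 r.2) *
      ((Real.exp (-v) - Real.exp (-3 * v)) / 2 *
        (auxD p.1 r.1 + auxD p.2 r.2 + auxD p.1 r.2 + auxD p.2 r.1)
      + ((1 - Real.exp (-4 * v)) / 2 - (Real.exp (-v) - Real.exp (-3 * v))) *
        (auxD p.1 r.1 * auxD p.2 r.2 + auxD p.1 r.2 * auxD p.2 r.1))) := by
  have q1 : Real.exp (-(v * 4) / 2) * Real.exp v = Real.exp (-v) := by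
    rw [← Real.exp_add]; congr 1; ring
  have q2 : Real.exp (-(v * 4) / 2) * Real.exp (-v) = Real.exp (-3 * v) := by
    rw [← Real.exp_add]; congr 1; ring
  have q3 : Real.exp (-(v * 4) / 2) * Real.exp (v * 2) = 1 := by
    rw [← Real.exp_add, ← Real.exp_zero]; congr 1; ring
  have q4 : Real.exp (-(v * 4) / 2) * Real.exp (-(v * 2)) = Real.exp (-4 * v) := by
    rw [← Real.exp_add]; congr 1; ring
  simp_rw [pow_two, auxW_sum]
  obtain ⟨k, l⟩ := p
  obtain ⟨k', l'⟩ := r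
  apply le_of_eq
  by_cases a1 : k = l
  · subst a1; simp [auxW, auxD]
  by_cases a2 : k' = l'
  · subst a2; simp [auxW, auxD]
  have a3 : l ≠ k := fun h => a1 h.symm
  have a4 : l' ≠ k' := fun h => a2 h.symm
  by_cases b1 : k = k' <;> by_cases b2 : l = l' <;> by_cases b3 : k = l' <;>
    by_cases b4 : l = k' <;> first
    | (exfalso; grind)
    | (simp only [auxW, auxD, a1, a2, a3, a4, b1, b2, b3, b4, if_true, if_false]
       try split_ifs
       all_goals first
         | (exfalso; grind)
         | (norm_num
            try simp only [mul_assoc, mul_sub, q1, q2, q3, q4]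
            try ring_nf))

lemma aux_count_s16 {n : ℕ} (c d : ℝ) :
    ∑ p : Fin n × Fin n, ∑ r : Fin n × Fin n, (1 - auxD p.1 p.2) * ((1 - auxD r.1 r.2) *
      (c * (auxD p.1 r.1 + auxD p.2 r.2 + auxD p.1 r.2 + auxD p.2 r.1)
      + d * (auxD p.1 r.1 * auxD p.2 r.2 + auxD p.1 r.2 * auxD p.2 r.1)))
    = (n : ℝ) * (n - 1) * (4 * c * (n - 1) + 2 * d) := by
  have h1 : ∀ p : Fin n × Fin n, ∑ r : Fin n × Fin n, (1 - auxD p.1 p.2) *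
      ((1 - auxD r.1 r.2) *
      (c * (auxD p.1 r.1 + auxD p.2 r.2 + auxD p.1 r.2 + auxD p.2 r.1)
      + d * (auxD p.1 r.1 * auxD p.2 r.2 + auxD p.1 r.2 * auxD p.2 r.1)))
      = (1 - auxD p.1 p.2) * (4 * c * (n - 1) + 2 * d) := by
    rintro ⟨k, l⟩
    by_cases hkl : k = l
    · simp [auxD, hkl]
    have hlk : l ≠ k := fun h => hkl h.symm
    rw [← Finset.mul_sum, Fintype.sum_prod_type]
    congr 1
    simp only [auxD, sub_mul, mul_add, Finset.sum_add_distrib, Finset.sum_sub_distrib, one_mul]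
    simp [hkl, hlk]
    ring
  simp_rw [h1]
  rw [← Finset.sum_mul, Fintype.sum_prod_type]
  congr 1
  simp [auxD, Finset.sum_sub_distrib]
  ring

lemma aux_JDG (n : ℕ) (h q : ℝ) (φ x : Fin n → ℝ) :
    JDG n h q (fun k => φ k + x k) = ∑ p : Fin n × Fin n,
      Real.cos (((q * h * (p.1 : ℕ) + φ p.1) - (q * h * (p.2 : ℕ) + φ p.2))
        + ∑ i, auxW p i * x i) := by
  simp_rw [auxW_sum]
  rw [Fintype.sum_prod_type]
  simp only
  set g : Fin n → Fin n → ℝ := fun l k =>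
    Real.cos (((q * h * (l : ℕ) + φ l) - (q * h * (k : ℕ) + φ k)) + (x l - x k)) with hg
  have hs : ∀ l k, g l k = g k l := by
    intro l k
    simp only [hg]
    rw [← Real.cos_neg]; congr 1; ring
  have hd : ∀ l, g l l = 1 := by intro l; simp [hg]
  have h1 : ∀ l k, g l k = (if k < l then g l k else 0) + (if l < k then g k l else 0)
      + (if l = k then 1 else 0) := by
    intro l k
    rcases lt_trichotomy l k with h | h | h
    · simp [h, h.not_gt, h.ne, hs l k]
    · subst h; simp [hd]
    · simp [h, h.not_gt, h.ne']
  have h2 : ∑ l, ∑ k, g l k = ∑ l, ∑ k, ((if k < l then g l k else 0) + (if l < k then g k l else 0)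
      + (if l = k then 1 else 0)) :=
    Finset.sum_congr rfl fun l _ => Finset.sum_congr rfl fun k _ => h1 l k
  rw [h2]
  simp only [Finset.sum_add_distrib]
  rw [Finset.sum_comm (f := fun l k => if l < k then g k l else 0)]
  have h3 : ∀ l k : Fin n, (if k < l then
      Real.cos (q * h * (((l : ℕ) - (k : ℕ) : ℕ) : ℝ) + ((φ l + x l) - (φ k + x k))) else 0)
      = if k < l then g l k else 0 := by
    intro l k
    split_ifs with hk
    · simp only [hg]
      rw [Nat.cast_sub (le_of_lt hk)]
      congr 1; ring
    · rfl
  unfold JDG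
  simp_rw [h3]
  simp
  ring

theorem JDG_noisy_variance_bound (n : ℕ) (hn : 2 ≤ n) (h q : ℝ) (ε : ℝ) (hε : 0 ≤ ε)
    (φ : Fin n → ℝ)
    (μ : Measure (Fin n → ℝ))
    (hμ : μ = Measure.pi fun _ : Fin n => gaussianReal 0 ⟨ε ^ 2, sq_nonneg ε⟩) :
    (∫ δφ, (JDG n h q (fun k => φ k + δφ k)) ^ 2 ∂μ) -
        (∫ δφ, JDG n h q (fun k => φ k + δφ k) ∂μ) ^ 2 ≤
      (n : ℝ) * ((n : ℝ) - 1) *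
        ((1 - Real.exp (-4 * ε ^ 2)) +
          2 * Real.exp (-ε ^ 2) * (1 - Real.exp (-2 * ε ^ 2)) * ((n : ℝ) - 2)) := by
  set v : NNReal := ⟨ε ^ 2, sq_nonneg ε⟩ with hv
  have hv' : (v : ℝ) = ε ^ 2 := rfl
  simp_rw [aux_JDG]
  set X : Fin n × Fin n → (Fin n → ℝ) → ℝ := fun p x =>
      Real.cos (((q * h * (p.1 : ℕ) + φ p.1) - (q * h * (p.2 : ℕ) + φ p.2))
        + ∑ i, auxW p i * x i) with hX
  have hXc : ∀ p, Continuous (X p) := by intro p; simp only [hX]; fun_prop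
  have hXb : ∀ p x, |X p x| ≤ 1 := fun p x => Real.abs_cos_le_one _
  have i1 : ∀ p, Integrable (X p) μ := fun p => hμ ▸ aux_int v _ (hXc p) (hXb p)
  have i2 : ∀ p r, Integrable (fun x => X p x * X r x) μ := fun p r =>
    hμ ▸ aux_int v _ ((hXc p).mul (hXc r)) (fun x => by
      rw [abs_mul]; exact mul_le_one₀ (hXb p x) (abs_nonneg _) (hXb r x))
  change (∫ x, (∑ p, X p x) ^ 2 ∂μ) - (∫ x, ∑ p, X p x ∂μ) ^ 2 ≤ _
  simp_rw [pow_two (∑ p, X p _), Finset.sum_mul_sum]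
  rw [integral_finsetSum _ (fun p _ => i1 p),
    integral_finsetSum _ (fun p _ => integrable_finsetSum _ (fun r _ => i2 p r)),
    pow_two, Finset.sum_mul_sum, ← Finset.sum_sub_distrib]
  have key : ∀ p r, (∫ x, X p x * X r x ∂μ) - (∫ x, X p x ∂μ) * (∫ x, X r x ∂μ) ≤ _ :=
    fun p r => (aux_cov v _ _ (auxW p) (auxW r) μ hμ).trans (aux_bound v p r)
  calc _ = ∑ p, ∑ r, ((∫ x, X p x * X r x ∂μ) - (∫ x, X p x ∂μ) * (∫ x, X r x ∂μ)) := by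
        refine Finset.sum_congr rfl fun p _ => ?_
        rw [integral_finsetSum _ (fun r _ => i2 p r), ← Finset.sum_sub_distrib]
    _ ≤ _ := Finset.sum_le_sum fun p _ => Finset.sum_le_sum fun r _ => key p r
    _ = _ := aux_count_s16 _ _
    _ = _ := by
        have : Real.exp (-3 * ε ^ 2) = Real.exp (-ε ^ 2) * Real.exp (-2 * ε ^ 2) := by
          rw [← Real.exp_add]; congr 1; ring
        rw [hv', this]
        ring
end

section
/- Let n ≥ 2 be an integer, h, q real numbers, ε ≥ 0, and φ : {0,…,n−1} → ℝ. Let δφ = (δφ_0,…,δφ_{n−1}) be a random vector whose components are independent, each with law N(0,ε²). Then Var[J_DG(q, φ + δφ)] ≤ 4·n·(n−1)²·ε². -/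
open Finset MeasureTheory ProbabilityTheory Real

lemma aux_int_s17 {Ω : Type*} [MeasurableSpace Ω] (μ : Measure Ω) [IsProbabilityMeasure μ]
    (f : Ω → ℝ) (hf : Measurable f) (C : ℝ) (hC : ∀ x, |f x| ≤ C) : MemLp f 2 μ :=
  MemLp.of_bound hf.aestronglyMeasurable C (Filter.Eventually.of_forall hC)

lemma aux_one (v : NNReal) (f : ℝ → ℝ) (hf : Measurable f) (C L : ℝ)
    (hC : ∀ x, |f x| ≤ C) (hL : ∀ x y, |f x - f y| ≤ L * |x - y|) :
    (∫ x, f x ^ 2 ∂(gaussianReal 0 v)) - (∫ x, f x ∂(gaussianReal 0 v)) ^ 2 ≤ L ^ 2 * v := by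
  have hm := aux_int_s17 (gaussianReal 0 v) f hf C hC
  have h1 := variance_eq_sub hm
  have h2 : Var[fun x => f x - f 0; gaussianReal 0 v] = Var[f; gaussianReal 0 v] :=
    variance_sub_const hm.aestronglyMeasurable (f 0)
  have h3 : Var[fun x => f x - f 0; gaussianReal 0 v] ≤
      ∫ x, (f x - f 0) ^ 2 ∂(gaussianReal 0 v) :=
    variance_le_expectation_sq (hf.sub_const _).aestronglyMeasurable
  have hid : MemLp (fun x : ℝ => x) 2 (gaussianReal 0 v) := memLp_id_gaussianReal 2
  have h5 : ∫ x, x ^ 2 ∂(gaussianReal 0 v) = v := by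
    have h6 := variance_eq_sub hid
    have h7 : Var[fun x => x; gaussianReal 0 v] = v := variance_fun_id_gaussianReal
    rw [h7] at h6
    simp only [integral_id_gaussianReal] at h6
    simpa using h6.symm
  have h4 : ∫ x, (f x - f 0) ^ 2 ∂(gaussianReal 0 v) ≤
      ∫ x, L ^ 2 * x ^ 2 ∂(gaussianReal 0 v) := by
    apply integral_mono_of_nonneg
    · exact Filter.Eventually.of_forall fun x => sq_nonneg _
    · exact hid.integrable_sq.const_mul _
    · refine Filter.Eventually.of_forall fun x => ?_
      have := hL x 0
      have h8 := pow_le_pow_left₀ (abs_nonneg _) this 2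
      simpa [mul_pow] using h8
  rw [integral_const_mul, h5] at h4
  have h9 : Var[f; gaussianReal 0 v] = (∫ x, f x ^ 2 ∂(gaussianReal 0 v)) - (∫ x, f x ∂(gaussianReal 0 v)) ^ 2 := h1
  linarith

lemma aux_pi (v : NNReal) (C L : ℝ) (n : ℕ) : ∀ (F : (Fin n → ℝ) → ℝ), Measurable F →
    (∀ x, |F x| ≤ C) → (∀ i x a, |F (Function.update x i a) - F x| ≤ L * |a - x i|) →
    (∫ x, F x ^ 2 ∂(Measure.pi fun _ : Fin n => gaussianReal 0 v)) -
      (∫ x, F x ∂(Measure.pi fun _ : Fin n => gaussianReal 0 v)) ^ 2 ≤ n * (L ^ 2 * v) := by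
  induction n with
  | zero =>
    intro F _ _ _
    rw [Measure.pi_of_empty (fun _ : Fin 0 => gaussianReal 0 v) (fun i => i.elim0)]
    simp
  | succ n ih =>
    intro F hF hC hL
    set γ := gaussianReal 0 v with hγ
    set P := Measure.pi fun _ : Fin n => γ with hP
    have mp := (measurePreserving_piFinSuccAbove (fun _ : Fin (n+1) => γ) 0).symm
    have key : ∀ g : (Fin (n+1) → ℝ) → ℝ, ∫ x, g x ∂(Measure.pi fun _ : Fin (n+1) => γ)
        = ∫ p, g (Fin.cons p.1 p.2) ∂(γ.prod P) := by
      intro g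
      rw [← mp.integral_comp (MeasurableEquiv.measurableEmbedding _) g]
      congr 1
      funext p
      congr 1
      funext j
      refine Fin.cases ?_ (fun j => ?_) j <;> simp [MeasurableEquiv.piFinSuccAbove]
    have hcons : Measurable fun p : ℝ × (Fin n → ℝ) => (Fin.cons p.1 p.2 : Fin (n+1) → ℝ) := by
      refine measurable_pi_iff.2 fun i => ?_
      refine Fin.cases ?_ (fun j => ?_) i
      · simpa using measurable_fst
      · simp only [Fin.cons_succ]
        fun_prop
    set H : ℝ × (Fin n → ℝ) → ℝ := fun p => F (Fin.cons p.1 p.2) with hH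
    have hHm : Measurable H := hF.comp hcons
    have hHC : ∀ p, |H p| ≤ C := fun p => hC _
    have hHl := aux_int_s17 (γ.prod P) H hHm C hHC
    have hsec : ∀ y, Measurable fun a => H (a, y) := fun y => hHm.comp (by fun_prop)
    have hsecl : ∀ y, MemLp (fun a => H (a, y)) 2 γ :=
      fun y => aux_int_s17 γ _ (hsec y) C (fun a => hHC _)
    set G : (Fin n → ℝ) → ℝ := fun y => ∫ a, H (a, y) ∂γ with hG
    have hGm : Measurable G :=
      (StronglyMeasurable.integral_prod_left' (μ := γ) hHm.stronglyMeasurable).measurable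
    have hGC : ∀ y, |G y| ≤ C := by
      intro y
      have := norm_integral_le_of_norm_le_const (μ := γ) (f := fun a => H (a, y))
        (Filter.Eventually.of_forall fun a => hHC (a, y))
      simpa using this
    have hGL : ∀ i y b, |G (Function.update y i b) - G y| ≤ L * |b - y i| := by
      intro i y b
      rw [hG]
      simp only
      rw [← integral_sub ((hsecl _).integrable (by norm_num)) ((hsecl _).integrable (by norm_num))]
      have := norm_integral_le_of_norm_le_const (μ := γ) (C := L * |b - y i|)
        (f := fun a => H (a, Function.update y i b) - H (a, y))
        (Filter.Eventually.of_forall fun a => by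
          have := hL i.succ (Fin.cons a y) b
          simpa [hH, Fin.cons_update] using this)
      simpa using this
    have hI := ih G hGm hGC hGL
    have hGl := aux_int_s17 P G hGm C hGC
    have hHi : Integrable H (γ.prod P) := hHl.integrable (by norm_num)
    have hH2 : Integrable (fun p => H p ^ 2) (γ.prod P) := hHl.integrable_sq
    rw [key, key (fun x => F x)]
    have e1 : ∫ p, F (Fin.cons p.1 p.2) ∂(γ.prod P) = ∫ y, G y ∂P :=
      integral_prod_symm H hHi
    have e2 : ∫ p, F (Fin.cons p.1 p.2) ^ 2 ∂(γ.prod P) = ∫ y, ∫ a, H (a, y) ^ 2 ∂γ ∂P :=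
      integral_prod_symm (fun p => H p ^ 2) hH2
    rw [e1, e2]
    have e3 : ∫ y, ∫ a, H (a, y) ^ 2 ∂γ ∂P ≤ ∫ y, (L ^ 2 * v + G y ^ 2) ∂P := by
      apply integral_mono
      · exact hH2.integral_prod_right
      · exact (integrable_const _).add hGl.integrable_sq
      · intro y
        have := aux_one v (fun a => H (a, y)) (hsec y) C L (fun a => hHC _) (by
          intro a b
          have := hL 0 (Fin.cons b y) a
          simpa [hH, Fin.update_cons_zero] using this)
        simp only [hG]
        linarith
    rw [integral_add (integrable_const _) hGl.integrable_sq] at e3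
    simp at e3
    push_cast
    linarith

lemma aux_lip (n : ℕ) (h q : ℝ) (i : Fin n) (x y : Fin n → ℝ) (hxy : ∀ j, j ≠ i → x j = y j) :
    |JDG n h q x - JDG n h q y| ≤ 2 * ((n : ℝ) - 1) * |x i - y i| := by
  have hcos : ∀ a b : ℝ, |cos a - cos b| ≤ |a - b| := fun a b => by
    simpa [Real.dist_eq] using Real.lipschitzWith_cos.dist_le_mul a b
  set d := |x i - y i| with hd
  have hd0 : 0 ≤ d := abs_nonneg _
  have hsum : |(∑ l : Fin n, ∑ k : Fin n,
      if k < l then Real.cos (q * h * (((l : ℕ) - (k : ℕ) : ℕ) : ℝ) + (x l - x k)) else 0) -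
      (∑ l : Fin n, ∑ k : Fin n,
      if k < l then Real.cos (q * h * (((l : ℕ) - (k : ℕ) : ℕ) : ℝ) + (y l - y k)) else 0)|
      ≤ ∑ l : Fin n, ∑ k : Fin n, ((if l = i then (if k < i then d else 0) else 0) +
          (if k = i then (if i < l then d else 0) else 0)) := by
    rw [← Finset.sum_sub_distrib]
    refine (Finset.abs_sum_le_sum_abs _ _).trans (Finset.sum_le_sum fun l _ => ?_)
    rw [← Finset.sum_sub_distrib]
    refine (Finset.abs_sum_le_sum_abs _ _).trans (Finset.sum_le_sum fun k _ => ?_)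
    by_cases hkl : k < l
    · simp only [hkl, if_true]
      refine (hcos _ _).trans ?_
      by_cases hl : l = i
      · subst hl
        have hk : k ≠ l := hkl.ne
        simp [hkl, hk, hxy k hk, hd]
      · by_cases hk : k = i
        · subst hk
          simp [hkl, hl, hxy l hl, hd, abs_sub_comm]
        · simp [hl, hk, hxy l hl, hxy k hk]
    · simp only [hkl, if_false, sub_zero, abs_zero]
      positivity
  have hcount : ∑ l : Fin n, ∑ k : Fin n, ((if l = i then (if k < i then d else 0) else 0) +
          (if k = i then (if i < l then d else 0) else 0)) = ((n : ℝ) - 1) * d := by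
    simp only [Finset.sum_add_distrib]
    rw [Finset.sum_comm]
    simp only [Finset.sum_ite_eq', Finset.mem_univ, if_true]
    rw [← Finset.sum_add_distrib]
    have : ∀ j : Fin n, ((if j < i then d else 0) + (if i < j then d else 0)) =
        d - (if j = i then d else 0) := by
      intro j
      rcases lt_trichotomy j i with hj | hj | hj
      · simp [hj, hj.ne, hj.not_gt]
      · simp [hj]
      · simp [hj, hj.ne', hj.not_gt]
    simp only [this, Finset.sum_sub_distrib]
    simp
    ring
  rw [hcount] at hsum
  unfold JDG
  rw [add_sub_add_left_eq_sub, ← mul_sub, abs_mul, abs_two]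
  linarith

theorem JDG_noisy_variance_bound_small (n : ℕ) (hn : 2 ≤ n) (h q : ℝ) (ε : ℝ) (hε : 0 ≤ ε)
    (φ : Fin n → ℝ)
    (μ : Measure (Fin n → ℝ))
    (hμ : μ = Measure.pi fun _ : Fin n => gaussianReal 0 ⟨ε ^ 2, sq_nonneg ε⟩) :
    (∫ δφ, (JDG n h q (fun k => φ k + δφ k)) ^ 2 ∂μ) -
        (∫ δφ, JDG n h q (fun k => φ k + δφ k) ∂μ) ^ 2 ≤
      4 * (n : ℝ) * ((n : ℝ) - 1) ^ 2 * ε ^ 2 := by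
  subst hμ
  have := aux_pi ⟨ε ^ 2, sq_nonneg ε⟩ (n + 2 * ∑ l : Fin n, ∑ k : Fin n, 1)
    (2 * ((n : ℝ) - 1)) n (fun δφ => JDG n h q (fun k => φ k + δφ k)) ?_ ?_ ?_
  · refine this.trans (le_of_eq ?_)
    change (n : ℝ) * ((2 * ((n : ℝ) - 1)) ^ 2 * ε ^ 2) = _
    ring
  · unfold JDG
    refine Measurable.const_add (Measurable.const_mul ?_ _) _
    refine Finset.measurable_sum _ fun l _ => Finset.measurable_sum _ fun k _ => ?_
    split_ifs
    · fun_prop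
    · fun_prop
  · intro x
    unfold JDG
    refine (abs_add_le _ _).trans ?_
    rw [abs_mul, abs_two, Nat.abs_cast]
    gcongr
    refine (Finset.abs_sum_le_sum_abs _ _).trans (Finset.sum_le_sum fun l _ => ?_)
    refine (Finset.abs_sum_le_sum_abs _ _).trans (Finset.sum_le_sum fun k _ => ?_)
    split_ifs
    · exact Real.abs_cos_le_one _
    · simp
  · intro i x a
    have := aux_lip n h q i (fun k => φ k + Function.update x i a k) (fun k => φ k + x k)
      (fun j hj => by simp [hj])
    simpa using this
end
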